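/- Let F be a free group of rank M, φ ∈ Aut(F) with [φ] of finite order in Out(F), and G = F ⋊_φ ℤ. Let H ≤ G be a finitely generated subgroup with H ∩ Z(G) = {1}. Then H is a free group. -/

import Mathlib

open SemidirectProduct Multiplicative

/-- The mapping torus `F ⋊_φ ⟨t⟩` of an automorphism `φ` of `F`: the semidirect
product `F ⋊ ℤ` in which the stable letter `t` satisfies `t⁻¹ x t = φ x`. -/
abbrev MappingTorus {F : Type*} [Group F] (φ : MulAut F) : Type _ :=
  SemidirectProduct F (Multiplicative ℤ) ((zpowersHom (MulAut F)) φ⁻¹)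

/-- The stable letter `t` of the mapping torus. -/
def stableLetter {F : Type*} [Group F] (φ : MulAut F) : MappingTorus φ :=
  inr (ofAdd 1)

/-! ### Cuts in a graph -/

section Cuts

variable {V E : Type*} (s t : E → V)

/-- The edges with exactly one endpoint in `C`, for the graph with edge set `E` and
endpoint maps `s` and `t`. -/
def coboundary (C : Set V) : Set E := {e | ¬(s e ∈ C ↔ t e ∈ C)}

/-- The subgraph spanned by the vertex set `C` and the given edges is connected. -/
def ConnectedIn (E' : Set E) (C : Set V) : Prop :=
  ∀ B ⊆ C, B.Nonempty → B ≠ C → ∃ e ∈ E', s e ∈ C ∧ t e ∈ C ∧ e ∈ coboundary s t B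

variable {s t}

lemma coboundary_compl (C : Set V) : coboundary s t Cᶜ = coboundary s t C := by
  ext e; simp [coboundary, not_iff_not]

/-- Two points either lie in a common component of a graph, or are separated by a set without
coboundary. -/
lemma exists_finite_hitting_set_or_component (E' : Set E) (x y : V) :
    (∃ F : Set E, F.Finite ∧ F ⊆ E' ∧
      ∀ C : Set V, ¬(x ∈ C ↔ y ∈ C) → ∃ f ∈ F, f ∈ coboundary s t C) ∨
    ∃ A : Set V, x ∈ A ∧ y ∉ A ∧ ∀ e ∈ E', e ∉ coboundary s t A := by
  let R : V → V → Prop := fun a b ↦ ∃ e ∈ E', (s e = a ∧ t e = b) ∨ (s e = b ∧ t e = a)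
  by_cases h : Relation.ReflTransGen R x y
  · left
    induction h with
    | refl => exact ⟨∅, Set.finite_empty, by simp, by simp⟩
    | @tail b c _ hbc ih =>
      obtain ⟨F, hF, hFE, hFC⟩ := ih
      obtain ⟨e, he, hends⟩ := hbc
      refine ⟨insert e F, hF.insert e, Set.insert_subset he hFE, fun C hC ↦ ?_⟩
      by_cases hb : x ∈ C ↔ b ∈ C
      · refine ⟨e, Set.mem_insert _ _, ?_⟩
        rcases hends with ⟨rfl, rfl⟩ | ⟨rfl, rfl⟩ <;> simp only [coboundary, Set.mem_ofPred_eq] <;>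
          tauto
      · obtain ⟨f, hf, hfC⟩ := hFC C hb
        exact ⟨f, Set.mem_insert_of_mem _ hf, hfC⟩
  · right
    refine ⟨{v | Relation.ReflTransGen R x v}, .refl, h, fun e he hcut ↦ hcut ?_⟩
    exact ⟨fun h' ↦ h'.tail ⟨e, he, .inl ⟨rfl, rfl⟩⟩, fun h' ↦ h'.tail ⟨e, he, .inr ⟨rfl, rfl⟩⟩⟩

lemma ConnectedIn.subset_or_disjoint {E' : Set E} {C A : Set V} (hC : ConnectedIn s t E' C)
    (hA : ∀ e ∈ E', s e ∈ C → t e ∈ C → e ∉ coboundary s t A) : C ⊆ A ∨ C ∩ A = ∅ := by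
  by_contra! h
  obtain ⟨h₁, h₂⟩ := h
  obtain ⟨e, he, hs, ht, hcut⟩ := hC (C ∩ A) Set.inter_subset_left h₂
    (fun h ↦ h₁ (Set.inter_eq_left.1 h))
  exact hA e he hs ht (by simpa [coboundary, hs, ht] using hcut)

/-- Only finitely many cuts of bounded size with both sides connected go through a given edge. -/
lemma finite_setOf_connected_cuts (k : ℕ) (E' : Set E) (e : E) (he : e ∈ E') :
    {C : Set V | e ∈ coboundary s t C ∧ (coboundary s t C ∩ E').encard ≤ k ∧
      ConnectedIn s t E' C ∧ ConnectedIn s t E' Cᶜ}.Finite := by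
  induction k generalizing E' e with
  | zero =>
    refine Set.finite_empty.subset ?_
    rintro C ⟨h, hk, -⟩
    simp only [CharP.cast_eq_zero, nonpos_iff_eq_zero, Set.encard_eq_zero] at hk
    exact hk.subset ⟨h, he⟩
  | succ k ih =>
    have key : ∀ C : Set V, e ∈ coboundary s t C → ConnectedIn s t E' C →
        ConnectedIn s t (E' \ {e}) C := by
      intro C heC hC B hB hne hneq
      obtain ⟨f, hf, hs, ht, hcut⟩ := hC B hB hne hneq
      refine ⟨f, ⟨hf, ?_⟩, hs, ht, hcut⟩
      rintro rfl
      exact heC ⟨fun _ ↦ ht, fun _ ↦ hs⟩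
    rcases exists_finite_hitting_set_or_component (s := s) (t := t) (E' \ {e}) (s e) (t e) with
      ⟨F, hF, hFE, hFC⟩ | ⟨A, hsA, htA, hA⟩
    · refine (hF.biUnion (t := fun f ↦ {C : Set V | f ∈ coboundary s t C ∧
        (coboundary s t C ∩ (E' \ {e})).encard ≤ k ∧
        ConnectedIn s t (E' \ {e}) C ∧ ConnectedIn s t (E' \ {e}) Cᶜ})
        fun f hf ↦ ih _ f (hFE hf)).subset ?_
      rintro C ⟨heC, hk, h₁, h₂⟩
      obtain ⟨f, hf, hfC⟩ := hFC C heC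
      refine Set.mem_biUnion hf ⟨hfC, ?_, key C heC h₁, key _ (by rwa [coboundary_compl]) h₂⟩
      rw [← Set.inter_sdiff_assoc]
      rw [← Set.encard_sdiff_singleton_add_one
        (show e ∈ coboundary s t C ∩ E' from ⟨heC, he⟩)] at hk
      push_cast at hk
      exact (ENat.add_le_add_iff_right (by simp)).1 hk
    · refine (Set.toFinite {A, Aᶜ}).subset ?_
      rintro C ⟨heC, -, h₁, h₂⟩
      have h₁' := (key C heC h₁).subset_or_disjoint (A := A) fun f hf _ _ ↦ hA f hf
      have h₂' := (key Cᶜ (by rwa [coboundary_compl]) h₂).subset_or_disjoint (A := A)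
        fun f hf _ _ ↦ hA f hf
      have hCA : ∀ D : Set V, D ⊆ A ∨ D ∩ A = ∅ → Dᶜ ⊆ A ∨ Dᶜ ∩ A = ∅ → s e ∈ D → t e ∉ D →
          D = A := by
        intro D h₁ h₂ hs ht
        have h₁ := h₁.resolve_right fun h ↦ h.subset ⟨hs, hsA⟩
        have h₂ := h₂.resolve_left fun h ↦ htA (h ht)
        refine h₁.antisymm fun v hv ↦ ?_
        by_contra hvD
        exact h₂.subset ⟨hvD, hv⟩
      by_cases hs : s e ∈ C
      · exact .inl (hCA C h₁' h₂' hs fun ht ↦ heC ⟨fun _ ↦ ht, fun _ ↦ hs⟩)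
      · refine .inr ?_
        rw [Set.mem_singleton_iff, ← hCA Cᶜ h₂' (by rwa [compl_compl]) hs ?_, compl_compl]
        exact fun ht ↦ heC ⟨fun h ↦ (hs h).elim, fun h ↦ (ht h).elim⟩

/-- Two sets are crossing if all four of their corners are nonempty. -/
def Crosses (C D : Set V) : Prop :=
  (C ∩ D).Nonempty ∧ (C ∩ Dᶜ).Nonempty ∧ (Cᶜ ∩ D).Nonempty ∧ (Cᶜ ∩ Dᶜ).Nonempty

lemma crosses_compl_left {C D : Set V} : Crosses Cᶜ D ↔ Crosses C D := by
  simp only [Crosses, compl_compl]; tauto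

lemma crosses_compl_right {C D : Set V} : Crosses C Dᶜ ↔ Crosses C D := by
  simp only [Crosses, compl_compl]; tauto

lemma coboundary_corners_union (C D : Set V) :
    coboundary s t (C ∩ D) ∪ coboundary s t (Cᶜ ∩ Dᶜ) ⊆ coboundary s t C ∪ coboundary s t D := by
  intro e
  simp only [coboundary, Set.mem_union, Set.mem_ofPred_eq, Set.mem_inter_iff, Set.mem_compl_iff]
  tauto

lemma coboundary_corners_inter (C D : Set V) :
    coboundary s t (C ∩ D) ∩ coboundary s t (Cᶜ ∩ Dᶜ) ⊆ coboundary s t C ∩ coboundary s t D := by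
  intro e
  simp only [coboundary, Set.mem_inter_iff, Set.mem_ofPred_eq, Set.mem_compl_iff]
  tauto

lemma crosses_corners_union {C D F : Set V}
    (h : Crosses F (C ∩ D) ∨ Crosses F (Cᶜ ∩ Dᶜ)) (hCD : Crosses C D) :
    Crosses F C ∨ Crosses F D := by
  by_contra! hn
  simp only [Crosses, Set.Nonempty, Set.mem_inter_iff, Set.mem_compl_iff] at *
  grind

lemma crosses_corners_inter {C D F : Set V}
    (h₁ : Crosses F (C ∩ D)) (h₂ : Crosses F (Cᶜ ∩ Dᶜ)) : Crosses F C ∧ Crosses F D := by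
  simp only [Crosses, Set.Nonempty, Set.mem_inter_iff, Set.mem_compl_iff] at *
  grind

lemma ncard_add_ncard_le {α : Type*} {A B C D : Set α} (hC : C.Finite) (hD : D.Finite)
    (hU : A ∪ B ⊆ C ∪ D) (hI : A ∩ B ⊆ C ∩ D) : A.ncard + B.ncard ≤ C.ncard + D.ncard := by
  have hfin := hC.union hD
  rw [← Set.ncard_union_add_ncard_inter A B (hfin.subset (Set.subset_union_left.trans hU))
      (hfin.subset (Set.subset_union_right.trans hU)),
    ← Set.ncard_union_add_ncard_inter C D hC hD]
  exact add_le_add (Set.ncard_le_ncard hU hfin)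
    (Set.ncard_le_ncard hI (hC.subset Set.inter_subset_left))

lemma ncard_add_ncard_lt {α : Type*} {A B C D : Set α} (hC : C.Finite) (hD : D.Finite)
    (hU : A ∪ B ⊂ C ∪ D) (hI : A ∩ B ⊆ C ∩ D) : A.ncard + B.ncard < C.ncard + D.ncard := by
  have hfin := hC.union hD
  rw [← Set.ncard_union_add_ncard_inter A B (hfin.subset (Set.subset_union_left.trans hU.1))
      (hfin.subset (Set.subset_union_right.trans hU.1)),
    ← Set.ncard_union_add_ncard_inter C D hC hD]
  exact add_lt_add_of_lt_of_le (Set.ncard_lt_ncard hU hfin)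
    (Set.ncard_le_ncard hI (hC.subset Set.inter_subset_left))

variable (s t) in
/-- The cuts with at most `k` edges that are of minimal size among the cuts separating
some pair of ultrafilters (for instance, of vertices or of ends). -/
def minCuts (k : ℕ) : Set (Set V) :=
  {C | (coboundary s t C).Finite ∧ (coboundary s t C).ncard ≤ k ∧ ∃ p q : Ultrafilter V,
    C ∈ p ∧ C ∉ q ∧ ∀ D : Set V, (coboundary s t D).Finite → D ∈ p → D ∉ q →
      (coboundary s t C).ncard ≤ (coboundary s t D).ncard}

variable (s t) in
/-- The size of a cut, refined by the number of minimal cuts crossing it. -/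
noncomputable def cutWeight (k : ℕ) (C : Set V) : ℕ ×ₗ ℕ :=
  toLex ((coboundary s t C).ncard, {F ∈ minCuts s t k | Crosses F C}.ncard)

variable (s t) in
/-- The cuts with at most `k` edges that are of minimal weight among the cuts separating
some pair of ultrafilters. -/
def optCuts (k : ℕ) : Set (Set V) :=
  {C | (coboundary s t C).Finite ∧ (coboundary s t C).ncard ≤ k ∧ ∃ p q : Ultrafilter V,
    C ∈ p ∧ C ∉ q ∧ ∀ D : Set V, (coboundary s t D).Finite → D ∈ p → D ∉ q →
      cutWeight s t k C ≤ cutWeight s t k D}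

lemma cutWeight_compl (k : ℕ) (C : Set V) : cutWeight s t k Cᶜ = cutWeight s t k C := by
  simp only [cutWeight, coboundary_compl, crosses_compl_right]

lemma minCuts_compl {k : ℕ} {C : Set V} (hC : C ∈ minCuts s t k) : Cᶜ ∈ minCuts s t k := by
  obtain ⟨hfin, hk, p, q, hp, hq, hmin⟩ := hC
  refine ⟨by rwa [coboundary_compl], by rwa [coboundary_compl], q, p,
    Ultrafilter.compl_mem_iff_notMem.2 hq, by simpa using hp, fun D hD hDq hDp ↦ ?_⟩
  have := hmin Dᶜ (by rwa [coboundary_compl]) (Ultrafilter.compl_mem_iff_notMem.2 hDp)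
    (by simpa using hDq)
  simpa only [coboundary_compl] using this

lemma optCuts_compl {k : ℕ} {C : Set V} (hC : C ∈ optCuts s t k) : Cᶜ ∈ optCuts s t k := by
  obtain ⟨hfin, hk, p, q, hp, hq, hmin⟩ := hC
  refine ⟨by rwa [coboundary_compl], by rwa [coboundary_compl], q, p,
    Ultrafilter.compl_mem_iff_notMem.2 hq, by simpa using hp, fun D hD hDq hDp ↦ ?_⟩
  have := hmin Dᶜ (by rwa [coboundary_compl]) (Ultrafilter.compl_mem_iff_notMem.2 hDp)
    (by simpa using hDq)
  simpa only [cutWeight_compl] using this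

lemma optCuts_subset_minCuts (k : ℕ) : optCuts s t k ⊆ minCuts s t k := by
  rintro C ⟨hfin, hk, p, q, hp, hq, hmin⟩
  refine ⟨hfin, hk, p, q, hp, hq, fun D hD hDp hDq ↦ ?_⟩
  rcases Prod.Lex.le_iff.1 (hmin D hD hDp hDq) with h | h
  · exact h.le
  · exact h.1.le

lemma optCuts_nonempty {k : ℕ} {C : Set V} (hC : C ∈ optCuts s t k) : C.Nonempty := by
  obtain ⟨-, -, p, q, hp, -⟩ := hC
  exact Ultrafilter.nonempty_of_mem hp

/-- A pair of ultrafilters separated by a cut with at most `k` edges is separated by an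
optimal one. -/
lemma exists_mem_optCuts {k : ℕ} {p q : Ultrafilter V} {A : Set V}
    (hfin : (coboundary s t A).Finite) (hk : (coboundary s t A).ncard ≤ k)
    (hp : A ∈ p) (hq : A ∉ q) : ∃ C ∈ optCuts s t k, C ∈ p ∧ C ∉ q := by
  obtain ⟨C, ⟨hCfin, hCp, hCq⟩, hmin⟩ := (InvImage.wf (cutWeight s t k) wellFounded_lt).has_min
    {C : Set V | (coboundary s t C).Finite ∧ C ∈ p ∧ C ∉ q} ⟨A, hfin, hp, hq⟩
  have hmin' : ∀ D : Set V, (coboundary s t D).Finite → D ∈ p → D ∉ q →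
      cutWeight s t k C ≤ cutWeight s t k D := fun D hD hDp hDq ↦ not_lt.1 (hmin D ⟨hD, hDp, hDq⟩)
  refine ⟨C, ⟨hCfin, ?_, p, q, hCp, hCq, hmin'⟩, hCp, hCq⟩
  rcases Prod.Lex.le_iff.1 (hmin' A hfin hp hq) with h | h
  · exact h.le.trans hk
  · exact h.1.le.trans hk

section Connected

variable (hconn : ∀ C : Set V, coboundary s t C = ∅ → C = ∅ ∨ C = Set.univ)
include hconn

lemma connectedIn_of_mem_minCuts {k : ℕ} {C : Set V} (hC : C ∈ minCuts s t k) :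
    ConnectedIn s t Set.univ C := by
  obtain ⟨hfin, -, p, q, hp, hq, hmin⟩ := hC
  intro B hB hne hneq
  by_contra! hcut
  have key : ∀ A ⊆ C, A.Nonempty → (C \ A).Nonempty →
      (∀ e, s e ∈ C → t e ∈ C → e ∉ coboundary s t A) → A ∈ p → False := by
    intro A hA hne hne' hcut hAp
    have hsub : coboundary s t A ⊆ coboundary s t C := by
      intro e he
      have h₁ := hcut e
      have h₂ := @hA (s e)
      have h₃ := @hA (t e)
      simp only [coboundary, Set.mem_ofPred_eq] at *
      tauto
    have hss : coboundary s t A ⊂ coboundary s t C := by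
      refine hsub.ssubset_of_ne fun heq ↦ ?_
      have hempty : coboundary s t (C \ A) = ∅ := by
        refine Set.eq_empty_of_forall_notMem fun e he ↦ ?_
        have h₁ := Set.ext_iff.1 heq e
        have h₂ := @hA (s e)
        have h₃ := @hA (t e)
        have h₄ := hcut e
        simp only [coboundary, Set.mem_ofPred_eq, Set.mem_sdiff] at *
        tauto
      rcases hconn (C \ A) hempty with h | h
      · exact hne'.ne_empty h
      · obtain ⟨a, ha⟩ := hne
        exact (h.symm.subset (Set.mem_univ a)).2 ha
    have := hmin A (hfin.subset hsub) hAp fun h ↦ hq (Filter.mem_of_superset h hA)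
    exact absurd (Set.ncard_lt_ncard hss hfin) (not_lt.2 this)
  have hdiff : (C \ B).Nonempty := Set.nonempty_of_not_subset fun h ↦ hneq (hB.antisymm h)
  by_cases hBp : B ∈ p
  · exact key B hB hne hdiff (fun e ↦ hcut e trivial) hBp
  · refine key (C \ B) Set.sdiff_subset hdiff ?_ (fun e hs ht he ↦ hcut e trivial hs ht ?_)
      (Filter.inter_mem hp (Ultrafilter.compl_mem_iff_notMem.2 hBp))
    · rwa [Set.sdiff_sdiff_cancel_left hB]
    · simp only [coboundary, Set.mem_ofPred_eq, Set.mem_sdiff] at *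
      tauto

lemma finite_minCuts_separating (k : ℕ) (x y : V) :
    {C ∈ minCuts s t k | ¬(x ∈ C ↔ y ∈ C)}.Finite := by
  rcases exists_finite_hitting_set_or_component (s := s) (t := t) Set.univ x y with
    ⟨F, hF, -, hFC⟩ | ⟨A, hx, hy, hA⟩
  · refine (hF.biUnion fun e _ ↦
      finite_setOf_connected_cuts (s := s) (t := t) k Set.univ e trivial).subset ?_
    rintro C ⟨hC, hxy⟩
    obtain ⟨e, he, heC⟩ := hFC C hxy
    refine Set.mem_biUnion he ⟨heC, ?_, connectedIn_of_mem_minCuts hconn hC,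
      connectedIn_of_mem_minCuts hconn (minCuts_compl hC)⟩
    rw [Set.inter_univ, ← hC.1.cast_ncard_eq]
    exact_mod_cast hC.2.1
  · rcases hconn A (Set.eq_empty_of_forall_notMem fun e ↦ hA e trivial) with rfl | rfl
    · exact hx.elim
    · exact (hy trivial).elim

lemma finite_minCuts_crossing (k : ℕ) {C : Set V} (hC : (coboundary s t C).Finite) :
    {F ∈ minCuts s t k | Crosses F C}.Finite := by
  refine (hC.biUnion fun e _ ↦ hC.biUnion fun e' _ ↦
    finite_minCuts_separating hconn k (s e) (s e')).subset ?_
  have key : ∀ F ∈ minCuts s t k, Crosses F C → ∃ e ∈ coboundary s t C, s e ∈ F := by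
    intro F hF hcr
    obtain ⟨e, -, hs, ht, he⟩ := connectedIn_of_mem_minCuts hconn hF (F ∩ C)
      Set.inter_subset_left hcr.1 fun h ↦ by
        obtain ⟨v, hv, hv'⟩ := hcr.2.1
        exact hv' (h.symm.subset hv).2
    exact ⟨e, by simpa [coboundary, hs, ht] using he, hs⟩
  rintro F ⟨hF, hcr⟩
  obtain ⟨e, he, hs⟩ := key F hF hcr
  obtain ⟨e', he', hs'⟩ := key Fᶜ (minCuts_compl hF) (crosses_compl_left.2 hcr)
  exact Set.mem_biUnion he (Set.mem_biUnion he' ⟨hF, fun h ↦ hs' (h.1 hs)⟩)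

lemma cutWeight_corners_lt {k : ℕ} {C D : Set V} (hC : C ∈ minCuts s t k)
    (hD : D ∈ minCuts s t k) (hCD : Crosses C D) :
    cutWeight s t k (C ∩ D) + cutWeight s t k (Cᶜ ∩ Dᶜ) <
      cutWeight s t k C + cutWeight s t k D := by
  have h₁ := ncard_add_ncard_le hC.1 hD.1 (coboundary_corners_union C D)
    (coboundary_corners_inter C D)
  have h₂ : {F ∈ minCuts s t k | Crosses F (C ∩ D)}.ncard +
      {F ∈ minCuts s t k | Crosses F (Cᶜ ∩ Dᶜ)}.ncard <
      {F ∈ minCuts s t k | Crosses F C}.ncard + {F ∈ minCuts s t k | Crosses F D}.ncard := by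
    refine ncard_add_ncard_lt (finite_minCuts_crossing hconn k hC.1)
      (finite_minCuts_crossing hconn k hD.1) ⟨?_, fun h ↦ ?_⟩ ?_
    · rintro F (hF | hF)
      · exact (crosses_corners_union (.inl hF.2) hCD).imp (fun h ↦ ⟨hF.1, h⟩) fun h ↦ ⟨hF.1, h⟩
      · exact (crosses_corners_union (.inr hF.2) hCD).imp (fun h ↦ ⟨hF.1, h⟩) fun h ↦ ⟨hF.1, h⟩
    · rcases h (Or.inr ⟨hC, hCD⟩ : C ∈ _ ∪ {F ∈ minCuts s t k | Crosses F D}) with h | h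
      · obtain ⟨v, hv, hv', -⟩ := h.2.2.2.1
        exact hv hv'
      · obtain ⟨v, hv, hv', -⟩ := h.2.1
        exact hv' hv
    · rintro F ⟨h, h'⟩
      have := crosses_corners_inter h.2 h'.2
      exact ⟨⟨h.1, this.1⟩, h.1, this.2⟩
  simp only [cutWeight, ← toLex_add, Prod.mk_add_mk, Prod.Lex.lt_iff, ofLex_toLex]
  exact h₁.lt_or_eq.imp id fun h ↦ ⟨h, h₂⟩

/-- Optimal cuts do not cross. -/
theorem not_crosses_of_mem_optCuts {k : ℕ} {C D : Set V} (hC : C ∈ optCuts s t k)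
    (hD : D ∈ optCuts s t k) : ¬Crosses C D := by
  intro hCD
  have hC' := optCuts_subset_minCuts k hC
  have hD' := optCuts_subset_minCuts k hD
  have h₁ := cutWeight_corners_lt hconn hC' hD' hCD
  have h₂ := cutWeight_corners_lt hconn hC' (minCuts_compl hD') (crosses_compl_right.2 hCD)
  have hfin : ∀ A B : Set V, (coboundary s t A).Finite → (coboundary s t B).Finite →
      (coboundary s t (A ∩ B)).Finite := fun A B hA hB ↦
    (hA.union hB).subset (Set.subset_union_left.trans (coboundary_corners_union A B))
  have hcC : (coboundary s t Cᶜ).Finite := by rw [coboundary_compl]; exact hC.1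
  have hcD : (coboundary s t Dᶜ).Finite := by rw [coboundary_compl]; exact hD.1
  have f₁ := hfin C D hC.1 hD.1
  have f₂ := hfin C Dᶜ hC.1 hcD
  have f₃ := hfin Cᶜ D hcC hD.1
  have f₄ := hfin Cᶜ Dᶜ hcC hcD
  rw [cutWeight_compl, compl_compl] at h₂
  have symm : ∀ {A : Set V} {p q : Ultrafilter V}, (∀ D : Set V, (coboundary s t D).Finite →
      D ∈ p → D ∉ q → cutWeight s t k A ≤ cutWeight s t k D) →
      ∀ D : Set V, (coboundary s t D).Finite → (D ∈ p ↔ D ∉ q) →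
        cutWeight s t k A ≤ cutWeight s t k D := by
    intro A p q h D hD hpq
    by_cases hp : D ∈ p
    · exact h D hD hp (hpq.1 hp)
    · rw [← cutWeight_compl k D]
      refine h Dᶜ (by rwa [coboundary_compl]) (Ultrafilter.compl_mem_iff_notMem.2 hp) ?_
      simpa using not_imp_comm.1 hpq.2 hp
  obtain ⟨-, -, p, q, hp, hq, hmin⟩ := hC
  obtain ⟨-, -, p', q', hp', hq', hmin'⟩ := hD
  have hmin := symm hmin
  have hmin' := symm hmin'
  have m₁ := hmin _ f₁
  have m₂ := hmin _ f₂
  have m₃ := hmin _ f₃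
  have m₄ := hmin _ f₄
  have n₁ := hmin' _ f₁
  have n₂ := hmin' _ f₂
  have n₃ := hmin' _ f₃
  have n₄ := hmin' _ f₄
  have hi : ∀ (r : Ultrafilter V) (A B : Set V), A ∩ B ∈ r ↔ A ∈ r ∧ B ∈ r :=
    fun r A B ↦ Filter.inter_mem_iff
  simp only [hi, Ultrafilter.compl_mem_iff_notMem, hp, hq, hp', hq', true_and, false_and,
    not_true, not_false_iff, and_true, and_false, iff_true, false_iff]
    at m₁ m₂ m₃ m₄ n₁ n₂ n₃ n₄
  have contra : ∀ {a b x y : ℕ ×ₗ ℕ}, x + y < a + b → a ≤ x → b ≤ y → False :=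
    fun h hx hy ↦ absurd h (not_lt.2 (add_le_add hx hy))
  have contra' : ∀ {a b x y x' y' : ℕ ×ₗ ℕ}, x + y < a + b → x' + y' < a + b →
      a ≤ x → a ≤ y → b ≤ x' → b ≤ y' → False := fun {a b _ _ _ _} h h' hx hy hx' hy' ↦ by
    have h₁ := (add_le_add hx hy).trans_lt h
    have h₂ := (add_le_add hx' hy').trans_lt h'
    exact lt_asymm (lt_of_add_lt_add_left h₁) (lt_of_add_lt_add_right h₂)
  have h₁' := h₁
  have h₂' := h₂
  rw [add_comm] at h₁' h₂'
  by_cases c₁ : D ∈ p <;> by_cases c₂ : D ∈ q <;> by_cases c₃ : C ∈ p' <;> by_cases c₄ : C ∈ q' <;>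
    simp only [c₁, c₂, c₃, c₄, forall_const, IsEmpty.forall_iff, not_true, not_false_iff]
      at m₁ m₂ m₃ m₄ n₁ n₂ n₃ n₄ <;>
    first
      | exact contra h₁ ‹_› ‹_›
      | exact contra h₁' ‹_› ‹_›
      | exact contra h₂ ‹_› ‹_›
      | exact contra h₂' ‹_› ‹_›
      | exact contra' h₁ h₂ ‹_› ‹_› ‹_› ‹_›
      | exact contra' h₂ h₁ ‹_› ‹_› ‹_› ‹_›

end Connected

lemma crosses_preimage (σ : V ≃ V) {C D : Set V} :
    Crosses (σ ⁻¹' C) (σ ⁻¹' D) ↔ Crosses C D := by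
  simp only [Crosses, ← Set.preimage_compl, ← Set.preimage_inter, σ.surjective.nonempty_preimage]

section Equivariance

variable {σ : V ≃ V} {τ : E ≃ E}

lemma coboundary_preimage (hs : ∀ e, s (τ e) = σ (s e)) (ht : ∀ e, t (τ e) = σ (t e))
    (C : Set V) : coboundary s t (σ ⁻¹' C) = τ ⁻¹' coboundary s t C := by
  ext e; simp [coboundary, hs, ht]

lemma finite_coboundary_preimage (hs : ∀ e, s (τ e) = σ (s e)) (ht : ∀ e, t (τ e) = σ (t e))
    {C : Set V} (hC : (coboundary s t C).Finite) : (coboundary s t (σ ⁻¹' C)).Finite := by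
  rw [coboundary_preimage hs ht]
  exact hC.preimage τ.injective.injOn

lemma ncard_coboundary_preimage (hs : ∀ e, s (τ e) = σ (s e)) (ht : ∀ e, t (τ e) = σ (t e))
    (C : Set V) : (coboundary s t (σ ⁻¹' C)).ncard = (coboundary s t C).ncard := by
  rw [coboundary_preimage hs ht]
  exact Set.ncard_preimage_of_injective_subset_range τ.injective (by simp)

lemma minCuts_preimage (hs : ∀ e, s (τ e) = σ (s e)) (ht : ∀ e, t (τ e) = σ (t e)) {k : ℕ}
    {C : Set V} (hC : C ∈ minCuts s t k) : σ ⁻¹' C ∈ minCuts s t k := by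
  have hs' : ∀ e, s (τ.symm e) = σ.symm (s e) := fun e ↦ by simp [Equiv.eq_symm_apply, ← hs]
  have ht' : ∀ e, t (τ.symm e) = σ.symm (t e) := fun e ↦ by simp [Equiv.eq_symm_apply, ← ht]
  obtain ⟨hfin, hk, p, q, hp, hq, hmin⟩ := hC
  refine ⟨finite_coboundary_preimage hs ht hfin, by rwa [ncard_coboundary_preimage hs ht],
    p.map σ.symm, q.map σ.symm, ?_, ?_, fun D hD hDp hDq ↦ ?_⟩
  · simpa [Ultrafilter.mem_map, Set.preimage_preimage] using hp
  · simpa [Ultrafilter.mem_map, Set.preimage_preimage] using hq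
  · rw [ncard_coboundary_preimage hs ht, ← ncard_coboundary_preimage hs' ht' D]
    exact hmin _ (finite_coboundary_preimage hs' ht' hD) hDp hDq

lemma cutWeight_preimage (hs : ∀ e, s (τ e) = σ (s e)) (ht : ∀ e, t (τ e) = σ (t e)) (k : ℕ)
    (C : Set V) : cutWeight s t k (σ ⁻¹' C) = cutWeight s t k C := by
  have hs' : ∀ e, s (τ.symm e) = σ.symm (s e) := fun e ↦ by simp [Equiv.eq_symm_apply, ← hs]
  have ht' : ∀ e, t (τ.symm e) = σ.symm (t e) := fun e ↦ by simp [Equiv.eq_symm_apply, ← ht]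
  have : {F ∈ minCuts s t k | Crosses F (σ ⁻¹' C)} =
      Set.preimage σ '' {F ∈ minCuts s t k | Crosses F C} := by
    ext F
    refine ⟨fun h ↦ ⟨σ.symm ⁻¹' F, ⟨minCuts_preimage hs' ht' h.1, ?_⟩, ?_⟩, ?_⟩
    · rw [← crosses_preimage σ]
      simpa [Set.preimage_preimage] using h.2
    · simp [Set.preimage_preimage]
    · rintro ⟨F, h, rfl⟩
      exact ⟨minCuts_preimage hs ht h.1, (crosses_preimage σ).2 h.2⟩
  simp only [cutWeight, ncard_coboundary_preimage hs ht, this,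
    Set.ncard_image_of_injective _ σ.surjective.preimage_injective]

lemma optCuts_preimage (hs : ∀ e, s (τ e) = σ (s e)) (ht : ∀ e, t (τ e) = σ (t e)) {k : ℕ}
    {C : Set V} (hC : C ∈ optCuts s t k) : σ ⁻¹' C ∈ optCuts s t k := by
  have hs' : ∀ e, s (τ.symm e) = σ.symm (s e) := fun e ↦ by simp [Equiv.eq_symm_apply, ← hs]
  have ht' : ∀ e, t (τ.symm e) = σ.symm (t e) := fun e ↦ by simp [Equiv.eq_symm_apply, ← ht]
  obtain ⟨hfin, hk, p, q, hp, hq, hmin⟩ := hC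
  refine ⟨finite_coboundary_preimage hs ht hfin, by rwa [ncard_coboundary_preimage hs ht],
    p.map σ.symm, q.map σ.symm, ?_, ?_, fun D hD hDp hDq ↦ ?_⟩
  · simpa [Ultrafilter.mem_map, Set.preimage_preimage] using hp
  · simpa [Ultrafilter.mem_map, Set.preimage_preimage] using hq
  · rw [cutWeight_preimage hs ht, ← cutWeight_preimage hs' ht' k D]
    exact hmin _ (finite_coboundary_preimage hs' ht' hD) hDp hDq

end Equivariance

end Cuts

open scoped Pointwise

/-! ### Groups acting on nested families of sets -/

section TreeSet

variable {G V : Type*} [Group G] [MulAction G V]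

/-- A family of sets invariant under complements and under the group `G`, without crossing pairs,
and such that any two points are separated by finitely many members only. -/
structure IsTreeSet (G : Type*) {V : Type*} [Group G] [MulAction G V] (𝓔 : Set (Set V)) : Prop where
  compl_mem : ∀ C ∈ 𝓔, Cᶜ ∈ 𝓔
  smul_mem : ∀ (g : G), ∀ C ∈ 𝓔, g • C ∈ 𝓔
  nonempty : ∀ C ∈ 𝓔, C.Nonempty
  not_crosses : ∀ C ∈ 𝓔, ∀ D ∈ 𝓔, ¬Crosses C D
  finite_separating : ∀ x y : V, {C ∈ 𝓔 | x ∉ C ∧ y ∈ C}.Finite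

lemma compl_ssubset_compl_iff {C D : Set V} : Cᶜ ⊂ Dᶜ ↔ D ⊂ C := compl_lt_compl_iff_lt

namespace IsTreeSet

variable {𝓔 : Set (Set V)}

lemma ne_compl (h𝓔 : IsTreeSet G 𝓔) {C : Set V} (hC : C ∈ 𝓔) : C ≠ Cᶜ := by
  intro h
  obtain ⟨x, hx⟩ := h𝓔.nonempty C hC
  exact (h.subset hx) hx

lemma exists_notMem (h𝓔 : IsTreeSet G 𝓔) {C : Set V} (hC : C ∈ 𝓔) : ∃ x, x ∉ C :=
  h𝓔.nonempty _ (h𝓔.compl_mem C hC)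

lemma ssubset_of_mem (h𝓔 : IsTreeSet G 𝓔) {C D : Set V} (hC : C ∈ 𝓔) (hD : D ∈ 𝓔) {x y z : V}
    (hxC : x ∉ C) (hxD : x ∉ D) (hyC : y ∈ C) (hyD : y ∈ D) (hzC : z ∈ C) (hzD : z ∉ D) :
    D ⊂ C := by
  refine ⟨fun v hv ↦ ?_, fun h ↦ hzD (h hzC)⟩
  by_contra hvC
  exact h𝓔.not_crosses C hC D hD ⟨⟨y, hyC, hyD⟩, ⟨z, hzC, hzD⟩, ⟨v, hvC, hv⟩, ⟨x, hxC, hxD⟩⟩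

/-- The translates of `D` under powers of an element translating `D` into itself leave any
finite set. -/
lemma exists_notMem_pow_smul (h𝓔 : IsTreeSet G 𝓔) {k : G} {D : Set V} (hD : D ∈ 𝓔)
    (hk : k • D ⊂ D) (x y : V) : ∃ j : ℕ, x ∉ k ^ j • D ∧ y ∉ k ^ j • D := by
  have hanti : StrictAnti fun j : ℕ ↦ k ^ j • D := by
    refine strictAnti_nat_of_succ_lt fun j ↦ ?_
    rw [pow_succ, mul_smul]
    exact ⟨Set.smul_set_mono hk.1, fun h ↦ hk.2 (Set.smul_set_subset_smul_set_iff.1 h)⟩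
  have key : ∀ x : V, ∃ j : ℕ, x ∉ k ^ j • D := by
    intro x
    by_contra! hx
    obtain ⟨y, hy⟩ := h𝓔.exists_notMem hD
    refine Set.infinite_range_of_injective hanti.injective
      ((h𝓔.finite_separating y x).subset ?_)
    rintro _ ⟨j, rfl⟩
    refine ⟨h𝓔.smul_mem _ _ hD, fun h ↦ hy ?_, hx j⟩
    simpa using hanti.antitone (Nat.zero_le j) h
  obtain ⟨i, hi⟩ := key x
  obtain ⟨j, hj⟩ := key y
  exact ⟨max i j, fun h ↦ hi (hanti.antitone (le_max_left i j) h),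
    fun h ↦ hj (hanti.antitone (le_max_right i j) h)⟩

/-- The orientation of a nested family towards one of its members. -/
def orientation (𝓔 : Set (Set V)) (C : Set V) : Set (Set V) := {D ∈ 𝓔 | C ⊆ D ∨ Cᶜ ⊂ D}

lemma smul_orientation (h𝓔 : IsTreeSet G 𝓔) (g : G) (C : Set V) :
    g • orientation 𝓔 C = orientation 𝓔 (g • C) := by
  ext D
  have h₁ : g⁻¹ • D ∈ 𝓔 ↔ D ∈ 𝓔 :=
    ⟨fun h ↦ by simpa using h𝓔.smul_mem g _ h, fun h ↦ h𝓔.smul_mem g⁻¹ _ h⟩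
  rw [Set.mem_smul_set_iff_inv_smul_mem]
  have h₂ : C ⊆ g⁻¹ • D ↔ g • C ⊆ D := by
    rw [Set.smul_set_subset_iff_subset_inv_smul_set]
  have h₃ : Cᶜ ⊂ g⁻¹ • D ↔ (g • C)ᶜ ⊂ D := by
    rw [← Set.smul_set_compl, Set.ssubset_iff_subset_ne, Set.ssubset_iff_subset_ne,
      Set.smul_set_subset_iff_subset_inv_smul_set, Ne, Ne, ← eq_inv_smul_iff]
  simp only [orientation, Set.mem_ofPred_eq, h₁, h₂, h₃]

lemma orientation_subset (h𝓔 : IsTreeSet G 𝓔) {C C' : Set V} (hC : C ∈ 𝓔) (hC' : C' ∈ 𝓔)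
    (hss : C' ⊂ C) (hcov : ∀ D ∈ 𝓔, C' ⊂ D → ¬D ⊂ C) :
    orientation 𝓔 C ⊆ orientation 𝓔 C'ᶜ := by
  rintro D ⟨hD, h | h⟩
  · refine ⟨hD, .inr ?_⟩
    rw [compl_compl]
    exact hss.trans_subset h
  · refine ⟨hD, ?_⟩
    rw [compl_compl]
    obtain ⟨x, hx⟩ := h𝓔.exists_notMem hC
    by_contra! hn
    have h₁ : (D ∩ C').Nonempty := by
      rw [← Set.not_disjoint_iff_nonempty_inter, ← Set.subset_compl_iff_disjoint_left]
      intro hsub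
      refine hcov Dᶜ (h𝓔.compl_mem D hD) (hsub.ssubset_of_ne ?_) ?_
      · rintro rfl
        exact hn.1 (compl_compl D).subset
      · rwa [← compl_ssubset_compl_iff, compl_compl]
    have h₂ : (Dᶜ ∩ C').Nonempty := by
      rw [← Set.not_disjoint_iff_nonempty_inter, ← Set.subset_compl_iff_disjoint_left, compl_compl]
      intro hsub
      refine hn.2 (hsub.ssubset_of_ne ?_)
      rintro rfl
      exact hx (hss.1 (h.1 hx))
    have h₃ : (Dᶜ ∩ C'ᶜ).Nonempty := by
      obtain ⟨v, hv, hvD⟩ := Set.not_subset.1 hn.1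
      exact ⟨v, hvD, hv⟩
    exact h𝓔.not_crosses D hD C' hC' ⟨h₁, ⟨x, h.1 hx, fun h' ↦ hx (hss.1 h')⟩, h₂, h₃⟩

/-- Every nontrivial element has a power translating a member of the family into itself. -/
def Loxodromic (G : Type*) {V : Type*} [Group G] [MulAction G V] (𝓔 : Set (Set V)) : Prop :=
  ∀ g : G, g ≠ 1 → ∃ D ∈ 𝓔, ∃ n : ℕ, g ^ n • D ⊂ D

lemma eq_one_of_mem_stabilizer (h𝓔 : IsTreeSet G 𝓔) (hlox : Loxodromic G 𝓔) {O : Set (Set V)}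
    (hO : ∀ D ∈ O, Dᶜ ∉ O) {x y : V} (hxy : ∀ D ∈ 𝓔, x ∈ D → y ∈ D → D ∈ O) {h : G}
    (hh : h ∈ MulAction.stabilizer G O) : h = 1 := by
  by_contra hne
  obtain ⟨D, hD, n, hn⟩ := hlox h hne
  have hk := Subgroup.pow_mem _ hh n
  generalize h ^ n = k at hn hk
  obtain ⟨i, hxi, hyi⟩ := h𝓔.exists_notMem_pow_smul hD hn x y
  obtain ⟨j, hxj, hyj⟩ := h𝓔.exists_notMem_pow_smul (h𝓔.compl_mem D hD) (k := k⁻¹) (by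
    rw [Set.smul_set_compl, compl_ssubset_compl_iff]
    refine ⟨?_, fun h ↦ hn.2 ?_⟩
    · rw [← Set.smul_set_subset_iff_subset_inv_smul_set]
      exact hn.1
    · rwa [Set.subset_smul_set_iff]) x y
  have h₁ : (k ^ i • D)ᶜ ∈ O := hxy _ (h𝓔.compl_mem _ (h𝓔.smul_mem _ _ hD)) hxi hyi
  rw [Set.smul_set_compl, Set.notMem_compl_iff] at hxj hyj
  have h₂ : k⁻¹ ^ j • D ∈ O := hxy _ (h𝓔.smul_mem _ _ hD) hxj hyj
  have hst : ∀ m ∈ MulAction.stabilizer G O, ∀ D ∈ O, m • D ∈ O := by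
    intro m hm D hD
    rw [← MulAction.mem_stabilizer_iff.1 hm]
    exact Set.smul_mem_smul_set hD
  have h₃ := hst (k ^ i) (Subgroup.pow_mem _ hk i) _ (hst (k ^ j) (Subgroup.pow_mem _ hk j) _ h₂)
  refine hO _ h₃ ?_
  rwa [inv_pow, smul_inv_smul]

lemma eq_one_of_mem_stabilizer_orientation (h𝓔 : IsTreeSet G 𝓔) (hlox : Loxodromic G 𝓔)
    {C : Set V} (hC : C ∈ 𝓔) {h : G} (hh : h ∈ MulAction.stabilizer G (orientation 𝓔 C)) :
    h = 1 := by
  obtain ⟨x, hx⟩ := h𝓔.nonempty C hC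
  obtain ⟨y, hy⟩ := h𝓔.exists_notMem hC
  refine h𝓔.eq_one_of_mem_stabilizer hlox ?_ (x := x) (y := y) ?_ hh
  · rintro D ⟨-, h | h⟩ ⟨-, h' | h'⟩
    · exact h' hx (h hx)
    · exact h'.2 (Set.compl_subset_compl.2 h)
    · exact h.2 (Set.subset_compl_comm.1 h')
    · exact h'.1 hy (h.1 hy)
  · intro D hD hxD hyD
    refine ⟨hD, ?_⟩
    by_contra! hn
    obtain ⟨v, hv, hvD⟩ := Set.not_subset.1 hn.1
    have : ¬Cᶜ ⊆ D := fun h ↦ hn.2 ⟨h, fun h' ↦ h' hxD hx⟩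
    obtain ⟨w, hw, hwD⟩ := Set.not_subset.1 this
    exact h𝓔.not_crosses C hC D hD ⟨⟨x, hx, hxD⟩, ⟨v, hv, hvD⟩, ⟨y, hy, hyD⟩, ⟨w, hw, hwD⟩⟩

lemma smul_ne_compl (h𝓔 : IsTreeSet G 𝓔) (hlox : Loxodromic G 𝓔)
    {C : Set V} (hC : C ∈ 𝓔) (h : G) : h • C ≠ Cᶜ := by
  intro heq
  have h₁ : h ^ 2 = 1 := by
    refine h𝓔.eq_one_of_mem_stabilizer_orientation hlox hC ?_
    rw [MulAction.mem_stabilizer_iff, h𝓔.smul_orientation, pow_two, mul_smul, heq,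
      Set.smul_set_compl, heq, compl_compl]
  obtain rfl : h = 1 := by
    by_contra hh
    obtain ⟨D, -, n, hD⟩ := hlox h hh
    have hsub := Set.smul_set_mono (a := h ^ n) hD.1
    rw [smul_smul, ← pow_add, ← two_mul, pow_mul, h₁, one_pow, one_smul] at hsub
    exact hD.2 hsub
  exact h𝓔.ne_compl hC (by simpa using heq)

lemma smul_compl_ne_of_covers (h𝓔 : IsTreeSet G 𝓔) (hlox : Loxodromic G 𝓔) {C C' : Set V}
    (hC : C ∈ 𝓔) (hC' : C' ∈ 𝓔) (hss : C' ⊂ C) (hcov : ∀ D ∈ 𝓔, C' ⊂ D → ¬D ⊂ C) (h : G) :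
    h • Cᶜ ≠ C' := by
  intro heq
  have h₁ : orientation 𝓔 C = orientation 𝓔 C'ᶜ := by
    refine (h𝓔.orientation_subset hC hC' hss hcov).antisymm ?_
    have := h𝓔.orientation_subset (h𝓔.compl_mem _ hC') (h𝓔.compl_mem _ hC)
      (compl_ssubset_compl_iff.2 hss) fun D hD h₁ h₂ ↦ hcov Dᶜ (h𝓔.compl_mem D hD)
        (by rwa [← compl_ssubset_compl_iff, compl_compl])
        (by rwa [← compl_ssubset_compl_iff, compl_compl])
    rwa [compl_compl] at this
  obtain rfl : h = 1 := by
    refine h𝓔.eq_one_of_mem_stabilizer_orientation hlox hC ?_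
    rw [MulAction.mem_stabilizer_iff, h𝓔.smul_orientation, h₁, ← heq, Set.smul_set_compl,
      compl_compl]
  rw [one_smul] at heq
  obtain ⟨x, hx⟩ := h𝓔.exists_notMem hC
  exact hx (hss.1 (heq.subset hx))

end IsTreeSet

open scoped Classical in
/-- The list of elements of a finite chain of sets, in descending order. -/
noncomputable def descList (S : Set (Set V)) : List (Set V) :=
  if h : ∃ l : List (Set V), l.Pairwise (· ⊃ ·) ∧ ∀ C, C ∈ l ↔ C ∈ S then h.choose else []

lemma descList_eq {V : Type*} {S : Set (Set V)} {l : List (Set V)} (hl : l.Pairwise (· ⊃ ·))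
    (hS : ∀ C, C ∈ l ↔ C ∈ S) : descList S = l := by
  have h : ∃ l : List (Set V), l.Pairwise (· ⊃ ·) ∧ ∀ C, C ∈ l ↔ C ∈ S := ⟨l, hl, hS⟩
  rw [descList, dif_pos h]
  have hnd : ∀ l : List (Set V), l.Pairwise (· ⊃ ·) → l.Nodup := fun l hl ↦
    hl.imp fun h ↦ h.ne'
  refine List.Perm.eq_of_pairwise (fun a b _ _ h h' ↦ (h.asymm h').elim) h.choose_spec.1 hl
    ((List.perm_ext_iff_of_nodup (hnd _ h.choose_spec.1) (hnd _ hl)).2 fun C ↦ ?_)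
  rw [h.choose_spec.2, hS]

lemma exists_pairwise_ssupset {S : Set (Set V)} (hfin : S.Finite)
    (hS : ∀ C ∈ S, ∀ D ∈ S, C ⊆ D ∨ D ⊆ C) :
    ∃ l : List (Set V), l.Pairwise (· ⊃ ·) ∧ ∀ C, C ∈ l ↔ C ∈ S := by
  induction hn : S.ncard generalizing S with
  | zero =>
    rw [Set.ncard_eq_zero hfin] at hn
    exact ⟨[], by simp [hn]⟩
  | succ n ih =>
    obtain ⟨M, hM⟩ := hfin.exists_maximal (Set.nonempty_of_ncard_ne_zero (by omega))
    obtain ⟨l, hl, hlS⟩ := ih (hfin.subset (Set.sdiff_subset (t := {M})))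
      (fun C hC D hD ↦ hS C hC.1 D hD.1) (by rw [Set.ncard_sdiff_singleton_of_mem hM.1, hn]; rfl)
    refine ⟨M :: l, List.pairwise_cons.2 ⟨fun D hD ↦ ?_, hl⟩, fun C ↦ ?_⟩
    · obtain ⟨hD, hDM⟩ := (hlS D).1 hD
      exact LE.le.ssubset_of_ne ((hS D hD M hM.1).elim id fun h ↦ hM.2 hD h) hDM
    · rw [List.mem_cons, hlS]
      by_cases h : C = M
      · simp [h, hM.1]
      · simp [h]

lemma descList_spec {S : Set (Set V)} (hfin : S.Finite)
    (hS : ∀ C ∈ S, ∀ D ∈ S, C ⊆ D ∨ D ⊆ C) :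
    (descList S).Pairwise (· ⊃ ·) ∧ ∀ C, C ∈ descList S ↔ C ∈ S := by
  obtain ⟨l, hl, hlS⟩ := exists_pairwise_ssupset hfin hS
  rw [descList_eq hl hlS]
  exact ⟨hl, hlS⟩

namespace IsTreeSet

variable {𝓔 : Set (Set V)}

/-- The members of the family separating `x` from `y`. -/
def between (𝓔 : Set (Set V)) (x y : V) : Set (Set V) := {C ∈ 𝓔 | x ∉ C ∧ y ∈ C}

lemma between_chain (h𝓔 : IsTreeSet G 𝓔) (x y : V) :
    ∀ C ∈ between 𝓔 x y, ∀ D ∈ between 𝓔 x y, C ⊆ D ∨ D ⊆ C := by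
  rintro C ⟨hC, hxC, hyC⟩ D ⟨hD, hxD, hyD⟩
  by_contra! hn
  obtain ⟨z, hzC, hzD⟩ := Set.not_subset.1 hn.1
  exact hn.2 (h𝓔.ssubset_of_mem hC hD hxC hxD hyC hyD hzC hzD).1

lemma exists_list_between (h𝓔 : IsTreeSet G 𝓔) (x y : V) (p : Set V → Prop) :
    ∃ l : List (Set V), l.Pairwise (· ⊃ ·) ∧ ∀ C, C ∈ l ↔ C ∈ 𝓔 ∧ x ∉ C ∧ y ∈ C ∧ p C := by
  obtain ⟨l, hl, h⟩ := exists_pairwise_ssupset (S := {C ∈ between 𝓔 x y | p C})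
    ((h𝓔.finite_separating x y).subset fun C hC ↦ hC.1)
    fun C hC D hD ↦ h𝓔.between_chain x y C hC.1 D hD.1
  refine ⟨l, hl, fun C ↦ ?_⟩
  rw [h]
  simp only [between, Set.mem_ofPred_eq, and_assoc]

lemma descList_between_spec (h𝓔 : IsTreeSet G 𝓔) (x y : V) :
    (descList (between 𝓔 x y)).Pairwise (· ⊃ ·) ∧
      ∀ C, C ∈ descList (between 𝓔 x y) ↔ C ∈ 𝓔 ∧ x ∉ C ∧ y ∈ C :=
  descList_spec (h𝓔.finite_separating x y) (h𝓔.between_chain x y)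

/-- The orbit of a set under the group. -/
abbrev orbitClass (G : Type*) {V : Type*} [Group G] [MulAction G V] (C : Set V) :
    MulAction.orbitRel.Quotient G (Set V) := Quotient.mk'' C

lemma orbitClass_eq_iff {C D : Set V} : orbitClass G C = orbitClass G D ↔ ∃ g : G, g • D = C := by
  rw [Quotient.eq'', MulAction.orbitRel_apply]
  rfl

/-- An equivariant labelling of sets by elements of a free group, taking complements
to inverses. -/
def label (G : Type*) {V : Type*} [Group G] [MulAction G V] (C : Set V) :
    FreeGroup (MulAction.orbitRel.Quotient G (Set V)) :=
  .of (orbitClass G C) * (.of (orbitClass G Cᶜ))⁻¹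

lemma label_compl (C : Set V) : label G Cᶜ = (label G C)⁻¹ := by simp [label]

lemma label_smul (g : G) (C : Set V) : label G (g • C) = label G C := by
  have h : ∀ C : Set V, orbitClass G (g • C) = orbitClass G C := fun C ↦
    orbitClass_eq_iff.2 ⟨g, rfl⟩
  rw [label, label, ← Set.smul_set_compl, h, h]

variable (G) in
/-- The product of the labels along the path from `x` to `y`. -/
noncomputable def cocycle (𝓔 : Set (Set V)) (x y : V) :
    FreeGroup (MulAction.orbitRel.Quotient G (Set V)) :=
  ((descList (between 𝓔 x y)).map (label G)).prod

lemma cocycle_mul (h𝓔 : IsTreeSet G 𝓔) (x y z : V) :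
    cocycle G 𝓔 x y * cocycle G 𝓔 y z = cocycle G 𝓔 x z := by
  obtain ⟨l₁, hl₁, h₁⟩ := h𝓔.exists_list_between x y (z ∈ ·)
  obtain ⟨l₂, hl₂, h₂⟩ := h𝓔.exists_list_between x y (z ∉ ·)
  obtain ⟨l₃, hl₃, h₃⟩ := h𝓔.exists_list_between x z (y ∉ ·)
  have hmem : ∀ C, C ∈ (l₂.map compl).reverse ↔ C ∈ 𝓔 ∧ x ∈ C ∧ y ∉ C ∧ z ∈ C := by
    intro C
    rw [List.mem_reverse, List.mem_map]
    constructor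
    · rintro ⟨D, hD, rfl⟩
      obtain ⟨hD, hx, hy, hz⟩ := (h₂ D).1 hD
      exact ⟨h𝓔.compl_mem D hD, hx, fun h ↦ h hy, hz⟩
    · rintro ⟨hC, hx, hy, hz⟩
      exact ⟨Cᶜ, (h₂ _).2 ⟨h𝓔.compl_mem C hC, fun h ↦ h hx, hy, fun h ↦ h hz⟩, compl_compl C⟩
  have e₁ : descList (between 𝓔 x y) = l₁ ++ l₂ := by
    refine descList_eq (List.pairwise_append.2 ⟨hl₁, hl₂, fun C hC D hD ↦ ?_⟩) fun C ↦ ?_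
    · obtain ⟨hC, hxC, hyC, hzC⟩ := (h₁ C).1 hC
      obtain ⟨hD, hxD, hyD, hzD⟩ := (h₂ D).1 hD
      exact h𝓔.ssubset_of_mem hC hD hxC hxD hyC hyD hzC hzD
    · rw [List.mem_append, h₁, h₂, between, Set.mem_ofPred_eq]
      tauto
  have e₂ : descList (between 𝓔 y z) = (l₂.map compl).reverse ++ l₃ := by
    refine descList_eq (List.pairwise_append.2 ⟨?_, hl₃, fun C hC D hD ↦ ?_⟩) fun C ↦ ?_
    · rw [List.pairwise_reverse, List.pairwise_map]
      exact hl₂.imp fun h ↦ compl_ssubset_compl_iff.2 h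
    · obtain ⟨hC, hxC, hyC, hzC⟩ := (hmem C).1 hC
      obtain ⟨hD, hxD, hzD, hyD⟩ := (h₃ D).1 hD
      exact h𝓔.ssubset_of_mem hC hD hyC hyD hzC hzD hxC hxD
    · rw [List.mem_append, hmem, h₃, between, Set.mem_ofPred_eq]
      tauto
  have e₃ : descList (between 𝓔 x z) = l₁ ++ l₃ := by
    refine descList_eq (List.pairwise_append.2 ⟨hl₁, hl₃, fun C hC D hD ↦ ?_⟩) fun C ↦ ?_
    · obtain ⟨hC, hxC, hyC, hzC⟩ := (h₁ C).1 hC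
      obtain ⟨hD, hxD, hzD, hyD⟩ := (h₃ D).1 hD
      exact h𝓔.ssubset_of_mem hC hD hxC hxD hzC hzD hyC hyD
    · rw [List.mem_append, h₁, h₃, between, Set.mem_ofPred_eq]
      tauto
  have hinv : ((l₂.map compl).reverse.map (label G)).prod = ((l₂.map (label G)).prod)⁻¹ := by
    rw [List.prod_inv_reverse, List.map_reverse, List.map_map, List.map_map]
    congr 3
    exact funext label_compl
  rw [cocycle, cocycle, cocycle, e₁, e₂, e₃]
  simp only [List.map_append, List.prod_append, hinv]
  group

lemma cocycle_smul (h𝓔 : IsTreeSet G 𝓔) (g : G) (x y : V) :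
    cocycle G 𝓔 (g • x) (g • y) = cocycle G 𝓔 x y := by
  obtain ⟨hl, h⟩ := h𝓔.descList_between_spec x y
  have : descList (between 𝓔 (g • x) (g • y)) = (descList (between 𝓔 x y)).map (g • ·) := by
    refine descList_eq ?_ fun C ↦ ?_
    · rw [List.pairwise_map]
      exact hl.imp fun h ↦
        ⟨Set.smul_set_mono h.1, fun h' ↦ h.2 (Set.smul_set_subset_smul_set_iff.1 h')⟩
    · rw [List.mem_map]
      constructor
      · rintro ⟨D, hD, rfl⟩
        obtain ⟨hD, hx, hy⟩ := (h D).1 hD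
        exact ⟨h𝓔.smul_mem g D hD, by simpa using hx, by simpa using hy⟩
      · rintro ⟨hC, hx, hy⟩
        refine ⟨g⁻¹ • C, (h _).2 ⟨h𝓔.smul_mem _ _ hC, ?_, ?_⟩, smul_inv_smul g C⟩
        · rwa [Set.mem_inv_smul_set_iff]
        · rwa [Set.mem_inv_smul_set_iff]
  rw [cocycle, cocycle, this, List.map_map]
  congr 2
  exact funext (label_smul g)

/-- The homomorphism to a free group reading off the labels from `x` to its translates. -/
noncomputable def toFreeGroup (h𝓔 : IsTreeSet G 𝓔) (x : V) :
    G →* FreeGroup (MulAction.orbitRel.Quotient G (Set V)) :=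
  .mk' (fun g ↦ cocycle G 𝓔 x (g • x)) fun g h ↦ by
    rw [← h𝓔.cocycle_mul x (g • x) ((g * h) • x), mul_smul, h𝓔.cocycle_smul]

lemma isReduced_flatMap {α β : Type*} (f f' : β → α) (l : List β) (hl : ∀ C ∈ l, f C ≠ f' C)
    (hl' : l.IsChain fun C D ↦ f' C ≠ f D) :
    FreeGroup.IsReduced (l.flatMap fun C ↦ [(f C, true), (f' C, false)]) := by
  induction l with
  | nil => exact List.isChain_nil
  | cons C l ih =>
    rw [FreeGroup.IsReduced] at ih ⊢
    have := ih (fun D hD ↦ hl D (List.mem_cons_of_mem _ hD)) hl'.tail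
    cases l with
    | nil => simpa using hl
    | cons D l =>
      simp only [List.flatMap_cons, List.cons_append, List.nil_append, List.isChain_cons_cons] at *
      simp_all

lemma descList_between_isChain (h𝓔 : IsTreeSet G 𝓔) (hlox : Loxodromic G 𝓔) (x y : V) :
    (descList (between 𝓔 x y)).IsChain fun C D ↦ orbitClass G Cᶜ ≠ orbitClass G D := by
  obtain ⟨hl, h⟩ := h𝓔.descList_between_spec x y
  generalize descList (between 𝓔 x y) = l at hl h
  rw [List.isChain_iff_getElem]
  rw [List.pairwise_iff_getElem] at hl
  intro i hi heq
  obtain ⟨g, hg⟩ := orbitClass_eq_iff.1 heq.symm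
  refine h𝓔.smul_compl_ne_of_covers hlox ((h _).1 (List.getElem_mem (by omega))).1
    ((h _).1 (List.getElem_mem hi)).1 (hl i (i + 1) (by omega) hi (by omega)) ?_ g hg
  intro D hD h₁ h₂
  have hDl : D ∈ l := (h D).2 ⟨hD, fun hx ↦ ((h _).1 (List.getElem_mem _)).2.1 (h₂.1 hx),
    h₁.1 ((h _).1 (List.getElem_mem _)).2.2⟩
  obtain ⟨j, hj, rfl⟩ := List.getElem_of_mem hDl
  rcases lt_trichotomy j i with hji | rfl | hji
  · exact h₂.asymm (hl j i hj (by omega) hji)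
  · exact h₂.ne rfl
  · rcases (show i + 1 ≤ j from hji).lt_or_eq with h' | rfl
    · exact h₁.asymm (hl (i + 1) j hi hj h')
    · exact h₁.ne rfl

lemma between_eq_empty_of_cocycle_eq_one (h𝓔 : IsTreeSet G 𝓔)
    (hlox : Loxodromic G 𝓔) {x y : V} (h : cocycle G 𝓔 x y = 1) : between 𝓔 x y = ∅ := by
  obtain ⟨-, hmem⟩ := h𝓔.descList_between_spec x y
  have hchain := h𝓔.descList_between_isChain hlox x y
  rw [cocycle] at h
  generalize descList (between 𝓔 x y) = l at *
  have hred := isReduced_flatMap (orbitClass G) (fun C ↦ orbitClass G Cᶜ) l (fun C hC heq ↦ by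
    obtain ⟨g, hg⟩ := orbitClass_eq_iff.1 heq.symm
    exact h𝓔.smul_ne_compl hlox ((hmem C).1 hC).1 g hg) hchain
  have hprod : (l.map (label G)).prod =
      FreeGroup.mk (l.flatMap fun C ↦ [(orbitClass G C, true), (orbitClass G Cᶜ, false)]) := by
    clear * -
    induction l with
    | nil => rfl
    | cons C l ih =>
      rw [List.map_cons, List.prod_cons, ih, List.flatMap_cons, ← FreeGroup.mul_mk]
      rfl
  rw [hprod] at h
  classical
  have h' := congrArg FreeGroup.toWord h
  rw [FreeGroup.toWord_mk, hred.reduce_eq, FreeGroup.toWord_one] at h'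
  refine Set.eq_empty_of_forall_notMem fun C hC ↦ ?_
  have := List.flatMap_eq_nil_iff.1 h' C ((hmem C).2 hC)
  simp at this

lemma toFreeGroup_injective (h𝓔 : IsTreeSet G 𝓔) (hlox : Loxodromic G 𝓔)
    (x : V) : Function.Injective (h𝓔.toFreeGroup x) := by
  rw [injective_iff_map_eq_one]
  intro g hg
  have hempty := h𝓔.between_eq_empty_of_cocycle_eq_one hlox hg
  have hmem : ∀ C ∈ 𝓔, (g • x ∈ C ↔ x ∈ C) := by
    refine fun C hC ↦ ⟨fun h ↦ ?_, fun h ↦ ?_⟩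
    · by_contra hx
      exact hempty.subset ⟨hC, hx, h⟩
    · by_contra hx
      exact hempty.subset ⟨h𝓔.compl_mem C hC, fun h' ↦ h' h, hx⟩
  refine h𝓔.eq_one_of_mem_stabilizer hlox (O := {C ∈ 𝓔 | x ∈ C}) (x := x) (y := x)
    (fun D hD hD' ↦ hD'.2 hD.2) (fun D hD hx _ ↦ ⟨hD, hx⟩) ?_
  rw [MulAction.mem_stabilizer_iff]
  ext C
  rw [Set.mem_smul_set_iff_inv_smul_mem]
  constructor
  · rintro ⟨h, hx⟩
    have : C ∈ 𝓔 := by simpa using h𝓔.smul_mem g _ h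
    exact ⟨this, (hmem C this).1 (by rwa [Set.mem_inv_smul_set_iff] at hx)⟩
  · rintro ⟨h, hx⟩
    exact ⟨h𝓔.smul_mem _ _ h, by rw [Set.mem_inv_smul_set_iff]; exact (hmem C h).2 hx⟩

/-- A group acting on a nested family of sets, such that nontrivial elements act
loxodromically, is free. -/
theorem isFreeGroup [Nonempty V] (h𝓔 : IsTreeSet G 𝓔)
    (hlox : Loxodromic G 𝓔) : IsFreeGroup G := by
  obtain ⟨x⟩ := ‹Nonempty V›
  exact .ofMulEquiv (MonoidHom.ofInjective (h𝓔.toFreeGroup_injective hlox x)).symm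

end IsTreeSet

end TreeSet

/-! ### Almost invariant sets in free groups -/

section AlmostInvariant

/-- The elements whose right translation changes membership in `A` at finitely many points only. -/
def almostStabilizer {Γ : Type*} [Group Γ] (A : Set Γ) : Subgroup Γ where
  carrier := {w | {x | ¬(x ∈ A ↔ x * w ∈ A)}.Finite}
  one_mem' := by simp
  mul_mem' {v w} hv hw := by
    refine (hv.union (hw.preimage (mul_left_injective v).injOn)).subset fun x hx ↦ ?_
    by_contra hn
    simp only [Set.mem_union, Set.mem_ofPred_eq, Set.mem_preimage, not_or, not_not] at hn
    exact hx (by rw [← mul_assoc]; exact hn.1.trans hn.2)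
  inv_mem' {w} hw := by
    refine (hw.preimage (mul_left_injective w⁻¹).injOn).subset fun x hx ↦ ?_
    simpa [not_iff_comm, iff_comm] using hx

lemma mem_almostStabilizer {Γ : Type*} [Group Γ] {A : Set Γ} {w : Γ} :
    w ∈ almostStabilizer A ↔ {x | ¬(x ∈ A ↔ x * w ∈ A)}.Finite := Iff.rfl

variable {α : Type*} [DecidableEq α]

lemma almostStabilizer_startsWith (b : α × Bool) :
    almostStabilizer (FreeGroup.startsWith b) = ⊤ := by
  rw [eq_top_iff, ← FreeGroup.closure_range_of, Subgroup.closure_le]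
  rintro _ ⟨a, rfl⟩
  refine (Set.toFinite {1, (FreeGroup.of a)⁻¹}).subset fun f hf ↦ ?_
  by_contra hn
  simp only [Set.mem_insert_iff, Set.mem_singleton_iff, not_or] at hn
  refine hf ?_
  have hred := FreeGroup.isReduced_toWord (x := f)
  have hf' := FreeGroup.mk_toWord (x := f)
  simp only [FreeGroup.startsWith, Set.mem_ofPred_eq]
  generalize f.toWord = L at hred hf'
  obtain rfl | ⟨L, y, rfl⟩ := L.eq_nil_or_concat'
  · exact (hn.1 hf'.symm).elim
  rw [← hf', FreeGroup.of, FreeGroup.mul_mk]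
  by_cases hy : y = (a, false)
  · have hL : L ≠ [] := by
      rintro rfl
      exact hn.2 (by rw [← hf', hy]; rfl)
    have : FreeGroup.mk (L ++ [y] ++ [(a, true)]) = FreeGroup.mk L := by
      rw [← FreeGroup.mul_mk, ← FreeGroup.mul_mk, mul_assoc, hy]
      exact mul_eq_left.2 (inv_mul_cancel (FreeGroup.of a))
    rw [this, FreeGroup.toWord_mk, (hred.infix (List.prefix_append _ _).isInfix).reduce_eq,
      List.getElem?_append_left (List.length_pos_iff.2 hL)]
  · have : FreeGroup.IsReduced (L ++ [y] ++ [(a, true)]) := by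
      refine List.isChain_append.2 ⟨hred, by simp, ?_⟩
      rintro y' hy' _ ⟨⟩ rfl
      simp at hy'
      subst hy'
      by_contra h
      exact hy (Prod.ext rfl (by simpa using h))
    rw [FreeGroup.toWord_mk, this.reduce_eq, List.getElem?_append_left (l₁ := L ++ [y]) (by simp)]

/-- Every nontrivial element of a free group is conjugate to an element `c` whose positive powers
all start with the same letter, which is not the first letter of a negative power. -/
lemma FreeGroup.exists_conj_startsWith {y : FreeGroup α} (hy : y ≠ 1) :
    ∃ (u c : FreeGroup α) (b : α × Bool), y = u * c * u⁻¹ ∧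
      (∀ n : ℕ, 0 < n → c ^ n ∈ startsWith b) ∧ ∀ n : ℕ, (c ^ n)⁻¹ ∉ startsWith b := by
  have hW := reduceCyclically.isCyclicallyReduced (isReduced_toWord (x := y))
  have hconj := reduceCyclically.conj_conjugator_reduceCyclically y.toWord
  generalize reduceCyclically y.toWord = W at hW hconj
  generalize reduceCyclically.conjugator y.toWord = U at hconj
  have hyW : y = mk U * mk W * (mk U)⁻¹ := by
    rw [inv_mk, mul_mk, mul_mk, hconj, mk_toWord]
  obtain _ | ⟨b, W'⟩ := W
  · exact (hy (by rw [hyW, ← one_eq_mk]; group)).elim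
  have hword : ∀ n : ℕ, (mk (b :: W') ^ n).toWord = (List.replicate n (b :: W')).flatten := by
    intro n
    rw [pow_mk, toWord_mk, (hW.flatten_replicate n).isReduced.reduce_eq]
  refine ⟨mk U, mk (b :: W'), b, hyW, fun n hn ↦ ?_, fun n hmem ↦ ?_⟩
  · obtain ⟨n, rfl⟩ := Nat.exists_eq_succ_of_ne_zero hn.ne'
    rw [startsWith, Set.mem_ofPred_eq, hword, List.replicate_succ]
    rfl
  · have hcyc := (hW.flatten_replicate n).2
    rw [startsWith, Set.mem_ofPred_eq, toWord_inv, hword] at hmem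
    obtain _ | n := n
    · simp [invRev] at hmem
    · have hhead : (List.replicate (n + 1) (b :: W')).flatten.head? = some b := by
        rw [List.replicate_succ]; rfl
      generalize (List.replicate (n + 1) (b :: W')).flatten = L at *
      rw [invRev, ← List.head?_eq_getElem?, List.head?_reverse, List.getLast?_map,
        Option.map_eq_some_iff] at hmem
      obtain ⟨a, ha, hab⟩ := hmem
      have := hcyc a ha b hhead (by rw [← hab])
      rw [← hab] at this
      simp at this

end AlmostInvariant

/-! ### Cayley graphs -/

section Cayley

variable {G : Type*} [Group G] {S : Set G}

/-- The origin of an edge of the Cayley graph. -/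
def cayleySrc (S : Set G) (e : G × S) : G := e.1

/-- The endpoint of an edge of the Cayley graph. -/
def cayleyTgt (S : Set G) (e : G × S) : G := e.1 * e.2

lemma mem_coboundary_cayley {C : Set G} {e : G × S} :
    e ∈ coboundary (cayleySrc S) (cayleyTgt S) C ↔ ¬(e.1 ∈ C ↔ e.1 * e.2 ∈ C) := Iff.rfl

lemma eq_empty_or_univ_of_coboundary_cayley (hS : Subgroup.closure S = ⊤) (C : Set G)
    (hC : coboundary (cayleySrc S) (cayleyTgt S) C = ∅) : C = ∅ ∨ C = Set.univ := by
  have key : ∀ g x : G, x ∈ C ↔ x * g ∈ C := by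
    intro g
    induction (by simp [hS] : g ∈ Subgroup.closure S) using Subgroup.closure_induction with
    | mem s hs =>
      intro x
      by_contra hn
      exact hC.subset (show (x, ⟨s, hs⟩) ∈ coboundary (cayleySrc S) (cayleyTgt S) C from hn)
    | one => simp
    | mul g h _ _ hg hh => exact fun x ↦ by rw [hg, hh, mul_assoc]
    | inv g _ hg => exact fun x ↦ by rw [hg (x * g⁻¹), inv_mul_cancel_right]
  refine C.eq_empty_or_nonempty.imp id ?_
  rintro ⟨x, hx⟩
  refine Set.eq_univ_of_forall fun y ↦ ?_
  rw [← mul_inv_cancel_left x y]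
  exact (key _ x).1 hx

lemma almostStabilizer_eq_top_of_coboundary_cayley (hS : Subgroup.closure S = ⊤) {C : Set G}
    (hC : (coboundary (cayleySrc S) (cayleyTgt S) C).Finite) : almostStabilizer C = ⊤ := by
  rw [eq_top_iff, ← hS, Subgroup.closure_le]
  intro s hs
  refine (hC.image Prod.fst).subset fun x hx ↦ ⟨(x, ⟨s, hs⟩), hx, rfl⟩

lemma smul_mem_optCuts_cayley {k : ℕ} (g : G) {C : Set G}
    (hC : C ∈ optCuts (cayleySrc S) (cayleyTgt S) k) :
    g • C ∈ optCuts (cayleySrc S) (cayleyTgt S) k := by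
  have := optCuts_preimage (σ := Equiv.mulLeft g⁻¹)
    (τ := (Equiv.mulLeft g⁻¹).prodCongr (Equiv.refl S)) (fun _ ↦ rfl)
    (fun e ↦ mul_assoc _ _ _) hC
  rwa [← Set.preimage_smul_inv]

lemma isTreeSet_optCuts_cayley (hS : Subgroup.closure S = ⊤) (k : ℕ) :
    IsTreeSet G (optCuts (cayleySrc S) (cayleyTgt S) k) where
  compl_mem _ := optCuts_compl
  smul_mem g _ := smul_mem_optCuts_cayley g
  nonempty _ := optCuts_nonempty
  not_crosses _ hC _ hD :=
    not_crosses_of_mem_optCuts (eq_empty_or_univ_of_coboundary_cayley hS) hC hD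
  finite_separating x y :=
    (finite_minCuts_separating (eq_empty_or_univ_of_coboundary_cayley hS) k x y).subset
      fun _ hC ↦ ⟨optCuts_subset_minCuts k hC.1, fun h ↦ hC.2.1 (h.2 hC.2.2)⟩

/-- An element whose positive and negative powers are separated by a small cut translates an
optimal cut into itself, up to inversion. -/
lemma exists_optCut_pow_smul_ssubset (hS : Subgroup.closure S = ⊤) {k : ℕ}
    {z : G} (hz : ¬IsOfFinOrder z) {A : Set G}
    (hfin : (coboundary (cayleySrc S) (cayleyTgt S) A).Finite)
    (hk : (coboundary (cayleySrc S) (cayleyTgt S) A).ncard ≤ k)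
    (hpos : ∀ᶠ n : ℕ in Filter.atTop, z ^ n ∈ A) (hneg : ∀ᶠ n : ℕ in Filter.atTop, (z ^ n)⁻¹ ∉ A) :
    ∃ D ∈ optCuts (cayleySrc S) (cayleyTgt S) k, z • D ⊂ D := by
  have hinj : Function.Injective fun n : ℕ ↦ z ^ n :=
    injective_pow_iff_not_isOfFinOrder.2 hz
  have hle : (Filter.hyperfilter ℕ : Filter ℕ) ≤ Filter.atTop := by
    rw [← Nat.cofinite_eq_atTop]
    exact Filter.hyperfilter_le_cofinite
  obtain ⟨C, hC, hCp, hCq⟩ := exists_mem_optCuts hfin hk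
    (p := (Filter.hyperfilter ℕ).map fun n ↦ z ^ n)
    (q := (Filter.hyperfilter ℕ).map fun n ↦ (z ^ n)⁻¹) (hle hpos)
    (by
      rw [← Ultrafilter.compl_mem_iff_notMem]
      exact hle hneg)
  have hCz : {x | ¬(x ∈ C ↔ x * z ∈ C)}.Finite := by
    rw [← mem_almostStabilizer, almostStabilizer_eq_top_of_coboundary_cayley hS hC.1]
    trivial
  have hev : ∀ P : ℕ → Prop, (∀ᶠ n in Filter.atTop, (P n ↔ P (n + 1))) →
      (∀ᶠ n in Filter.hyperfilter ℕ, P n) → ∀ᶠ n in Filter.atTop, P n := by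
    intro P hP hPh
    obtain ⟨N, hN⟩ := Filter.eventually_atTop.1 hP
    obtain ⟨M, hM, hMN⟩ := (hPh.and (hle (Filter.eventually_ge_atTop N))).exists
    refine Filter.eventually_atTop.2 ⟨M, fun n hn ↦ ?_⟩
    induction n, hn using Nat.le_induction with
    | base => exact hM
    | succ n hn ih => exact (hN n (hMN.trans hn)).1 ih
  have hpos' : ∀ᶠ n : ℕ in Filter.atTop, z ^ n ∈ C := by
    refine hev _ ?_ hCp
    rw [← Nat.cofinite_eq_atTop]
    filter_upwards [(hCz.preimage hinj.injOn).compl_mem_cofinite] with n hn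
    rw [pow_succ]
    simpa using hn
  have hneg' : ∀ᶠ n : ℕ in Filter.atTop, (z ^ n)⁻¹ ∉ C := by
    refine hev _ ?_ (Ultrafilter.compl_mem_iff_notMem.2 hCq)
    rw [← Nat.cofinite_eq_atTop]
    have hinj' : Function.Injective fun n : ℕ ↦ (z ^ (n + 1))⁻¹ :=
      inv_injective.comp (hinj.comp (add_left_injective 1))
    filter_upwards [(hCz.preimage hinj'.injOn).compl_mem_cofinite] with n hn
    have hmul : (z ^ (n + 1))⁻¹ * z = (z ^ n)⁻¹ := by rw [pow_succ']; group
    simp only [Set.mem_compl_iff, Set.mem_preimage, Set.mem_ofPred_eq, not_not, hmul] at hn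
    rw [hn]
  have hzC : ∀ x, x ∈ z • C ↔ z⁻¹ * x ∈ C := fun x ↦ Set.mem_smul_set_iff_inv_smul_mem
  have hne : z • C ≠ C := by
    intro heq
    have hall : ∀ n : ℕ, z ^ n ∈ C ↔ (z ^ n)⁻¹ ∈ C := by
      have h1 : ∀ x, x ∈ C ↔ z⁻¹ * x ∈ C := fun x ↦ by rw [← hzC, heq]
      have h2 : ∀ (n : ℕ) x, x ∈ C ↔ (z ^ n)⁻¹ * x ∈ C := by
        intro n
        induction n with
        | zero => simp
        | succ n ih => exact fun x ↦ by rw [ih, h1, ← mul_assoc, pow_succ, mul_inv_rev]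
      exact fun n ↦ by rw [h2 n, inv_mul_cancel, h2 n 1, mul_one]
    obtain ⟨n, h₁, h₂⟩ := (hpos'.and hneg').exists
    exact h₂ ((hall n).1 h₁)
  have hcross := not_crosses_of_mem_optCuts (eq_empty_or_univ_of_coboundary_cayley hS) hC
    (smul_mem_optCuts_cayley z hC)
  obtain ⟨N, hN⟩ := Filter.eventually_atTop.1 (hpos'.and hneg')
  have hmem : z ^ (N + 1) ∈ C ∩ z • C :=
    ⟨(hN _ (by omega)).1, by rw [hzC, pow_succ', inv_mul_cancel_left]; exact (hN N le_rfl).1⟩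
  have hnmem : (z ^ N)⁻¹ ∈ Cᶜ ∩ (z • C)ᶜ :=
    ⟨(hN N le_rfl).2, by
      rw [Set.mem_compl_iff, hzC, ← mul_inv_rev, ← pow_succ]; exact (hN _ (by omega)).2⟩
  by_cases hsub : z • C ⊆ C
  · exact ⟨C, hC, LE.le.ssubset_of_ne hsub hne⟩
  · refine ⟨Cᶜ, optCuts_compl hC, ?_⟩
    rw [Set.smul_set_compl, compl_ssubset_compl_iff]
    refine LE.le.ssubset_of_ne (fun x hx ↦ ?_) hne.symm
    by_contra hx'
    obtain ⟨w, hw, hwC⟩ := Set.not_subset.1 hsub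
    exact hcross ⟨⟨_, hmem⟩, ⟨x, hx, hx'⟩, ⟨w, hwC, hw⟩, ⟨_, hnmem⟩⟩

end Cayley

/-! ### Torsion-free virtually free groups -/

section VirtuallyFree

variable {G : Type*} [Group G]

/-- Pulling back the translates of an almost invariant set along an equivariant map from `G` to a
group acted on by a finite index subgroup yields cuts of bounded size. -/
lemma exists_equivariant_map {Γ : Type*} [Group Γ] {S : Set G} (hS : S.Finite) {K : Subgroup G}
    [K.FiniteIndex] {ι : K →* Γ} (hι : Function.Injective ι) :
    ∃ ρ : G → Γ, (∀ (k : K) (g : G), ρ (k * g) = ι k * ρ g) ∧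
      ∀ A : Set Γ, almostStabilizer A = ⊤ → ∃ k, ∀ u : Γ,
        (coboundary (cayleySrc S) (cayleyTgt S) {g | u⁻¹ * ρ g ∈ A}).Finite ∧
        (coboundary (cayleySrc S) (cayleyTgt S) {g | u⁻¹ * ρ g ∈ A}).ncard ≤ k := by
  obtain ⟨T, hT, -⟩ := K.exists_isComplement_right 1
  have : Finite T := hT.finite_right
  have : Finite S := hS
  have hρ : ∀ (k : K) (g : G), ι (hT.equiv (k * g)).1 = ι k * ι (hT.equiv g).1 := fun k g ↦ by
    rw [hT.equiv_mul_left, map_mul]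
  refine ⟨fun g ↦ ι (hT.equiv g).1, hρ, fun A hA ↦ ?_⟩
  have hW : {w : Γ × T × S | ¬(w.1 ∈ A ↔ w.1 * ι (hT.equiv (w.2.1 * w.2.2)).1 ∈ A)}.Finite := by
    have hfin : ∀ r : T × S,
        {x | ¬(x ∈ A ↔ x * ι (hT.equiv (r.1 * r.2)).1 ∈ A)}.Finite := fun r ↦ by
      rw [← mem_almostStabilizer, hA]
      trivial
    refine (Set.finite_iUnion fun r : T × S ↦ (hfin r).image fun x ↦ (x, r)).subset ?_
    rintro ⟨x, r⟩ hx
    exact Set.mem_iUnion.2 ⟨r, x, hx, rfl⟩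
  refine ⟨{w : Γ × T × S |
    ¬(w.1 ∈ A ↔ w.1 * ι (hT.equiv (w.2.1 * w.2.2)).1 ∈ A)}.ncard, fun u ↦ ?_⟩
  let f : G × S → Γ × T × S := fun e ↦ (u⁻¹ * ι (hT.equiv e.1).1, (hT.equiv e.1).2, e.2)
  have hf : Function.Injective f := by
    rintro ⟨g, s⟩ ⟨g', s'⟩ h
    simp only [f, Prod.mk.injEq, mul_right_inj, hι.eq_iff] at h
    rw [Prod.mk.injEq]
    exact ⟨hT.equiv.injective (Prod.ext h.1 h.2.1), h.2.2⟩
  have hsub : coboundary (cayleySrc S) (cayleyTgt S) {g | u⁻¹ * ι (hT.equiv g).1 ∈ A} ⊆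
      f ⁻¹' {w | ¬(w.1 ∈ A ↔ w.1 * ι (hT.equiv (w.2.1 * w.2.2)).1 ∈ A)} := by
    rintro ⟨g, s⟩ h
    rw [mem_coboundary_cayley] at h
    have hg : ι (hT.equiv (g * s)).1 =
        ι (hT.equiv g).1 * ι (hT.equiv ((hT.equiv g).2 * s)).1 := by
      rw [← hρ, ← mul_assoc, hT.equiv_fst_mul_equiv_snd]
    simpa [f, hg, mul_assoc] using h
  have hpre := hW.preimage hf.injOn
  refine ⟨hpre.subset hsub, (Set.ncard_le_ncard hsub hpre).trans ?_⟩
  rw [← Set.ncard_image_of_injective _ hf]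
  exact Set.ncard_le_ncard (Set.image_preimage_subset _ _) hW

/-- A finitely generated torsion-free virtually free group is free. -/
theorem isFreeGroup_of_finiteIndex [Group.FG G] (htf : ∀ g : G, IsOfFinOrder g → g = 1)
    {α : Type*} [Finite α] {K : Subgroup G} [K.FiniteIndex] {ι : K →* FreeGroup α}
    (hι : Function.Injective ι) :
    IsFreeGroup G := by
  classical
  obtain ⟨S, hS, hSfin⟩ := Group.fg_iff.1 ‹Group.FG G›
  obtain ⟨ρ, hρ, hcut⟩ := exists_equivariant_map hSfin hι
  choose k hk using fun b : α × Bool ↦ hcut _ (almostStabilizer_startsWith b)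
  obtain ⟨m, hm⟩ := (Set.finite_range k).bddAbove
  refine (isTreeSet_optCuts_cayley hS m).isFreeGroup fun g hg ↦ ?_
  obtain ⟨n, hn, -, hgn⟩ := Subgroup.exists_pow_mem_of_index_ne_zero
    (Subgroup.FiniteIndex.index_ne_zero (H := K)) g
  have hz : ¬IsOfFinOrder (g ^ n) := fun h ↦ hg (htf g (h.of_pow hn.ne'))
  have hy : ι ⟨g ^ n, hgn⟩ ≠ 1 := fun h ↦ hz (by
    have := (injective_iff_map_eq_one ι).1 hι _ h
    simp_all)
  obtain ⟨u, c, b, hιy, hpos, hneg⟩ := FreeGroup.exists_conj_startsWith hy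
  have hρpow : ∀ j : ℕ, ρ ((g ^ n) ^ j) = u * c ^ j * u⁻¹ * ρ 1 := fun j ↦ by
    have := hρ (⟨g ^ n, hgn⟩ ^ j) 1
    rwa [map_pow, hιy, conj_pow, mul_one] at this
  have hρinv : ∀ j : ℕ, ρ ((g ^ n) ^ j)⁻¹ = u * (c ^ j)⁻¹ * u⁻¹ * ρ 1 := fun j ↦ by
    have := hρ (⟨g ^ n, hgn⟩ ^ j)⁻¹ 1
    rwa [map_inv, map_pow, hιy, conj_pow, conj_inv, mul_one] at this
  have halmost : {x | ¬(x ∈ FreeGroup.startsWith b ↔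
      x * (u⁻¹ * ρ 1) ∈ FreeGroup.startsWith b)}.Finite := by
    rw [← mem_almostStabilizer, almostStabilizer_startsWith]
    trivial
  have hc : c ≠ 1 := by
    rintro rfl
    simp at hιy
    exact hy hιy
  have hinj : Function.Injective fun n : ℕ ↦ c ^ n :=
    injective_pow_iff_not_isOfFinOrder.2 (not_isOfFinOrder_of_isMulTorsionFree hc)
  obtain ⟨D, hD, hss⟩ := exists_optCut_pow_smul_ssubset hS hz (hk b u).1
    ((hk b u).2.trans (hm ⟨b, rfl⟩)) (by
      filter_upwards [Nat.cofinite_eq_atTop ▸ (halmost.preimage hinj.injOn).compl_mem_cofinite,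
        Filter.eventually_gt_atTop 0] with j hj hj'
      simp only [Set.mem_compl_iff, Set.mem_preimage, Set.mem_ofPred_eq, not_not] at hj ⊢
      rw [hρpow]
      simpa [mul_assoc] using hj.1 (hpos j hj')) (by
      filter_upwards [Nat.cofinite_eq_atTop ▸
        (halmost.preimage (inv_injective.comp hinj).injOn).compl_mem_cofinite] with j hj
      simp only [Set.mem_compl_iff, Set.mem_preimage, Set.mem_ofPred_eq, not_not,
        Function.comp_apply] at hj ⊢
      rw [hρinv]
      simpa [mul_assoc] using fun h ↦ hneg j (hj.2 h))
  exact ⟨D, hD, n, hss⟩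

end VirtuallyFree

/-! ### The center of a mapping torus -/

section MappingTorus

variable {F : Type*} [Group F] {φ : MulAut F}

lemma exists_pow_eq_conj_of_fixed {k : ℕ} (hk : 0 < k) {f₀ : F} (h : φ ^ k = MulAut.conj f₀) :
    ∃ n : ℕ, 0 < n ∧ ∃ f, φ ^ n = MulAut.conj f ∧ φ f = f := by
  let N : ℕ → F := Nat.rec 1 fun _ x ↦ f₀ * φ x
  have hN : ∀ i, N (i + 1) = f₀ * φ (N i) := fun _ ↦ rfl
  have hN' : ∀ i, N (i + 1) = N i * (φ ^ i) f₀ := by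
    intro i
    induction i with
    | zero => simp [N]
    | succ i ih => rw [hN (i + 1), ih, map_mul, ← mul_assoc, ← hN, pow_succ', MulAut.mul_apply, ih]
  have hconj : ∀ i, MulAut.conj (N i) = φ ^ (k * i) := by
    intro i
    induction i with
    | zero => simp [N]
    | succ i ih =>
      have hφ : MulAut.conj (φ (N i)) = φ * MulAut.conj (N i) * φ⁻¹ := by
        ext x; simp [MulAut.mul_apply]
      rw [hN, map_mul, hφ, ih, ← h]
      group
  have hfix : (φ ^ k) f₀ = f₀ := by simp [h]
  have hcomm : N k * f₀ = f₀ * N k := by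
    rw [← mul_inv_eq_iff_eq_mul, ← MulAut.conj_apply, hconj, pow_mul]
    clear * - hfix
    generalize φ ^ k = ψ at hfix
    induction k with
    | zero => rfl
    | succ k ih => rw [pow_succ, MulAut.mul_apply, hfix, ih]
  refine ⟨k * k, Nat.mul_pos hk hk, N k, (hconj k).symm, ?_⟩
  rw [← mul_right_inj f₀, ← hN, hN', hfix, hcomm]

lemma inl_mul_inr_pow_mem_center {n : ℕ} {f : F} (hn : φ ^ n = MulAut.conj f) (hf : φ f = f) :
    (inl f * inr (ofAdd (n : ℤ)) : MappingTorus φ) ∈ Subgroup.center (MappingTorus φ) := by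
  have hpow : ∀ m : ℤ, (φ ^ m).symm f = f := by
    intro m
    have : φ ∈ MulAction.stabilizer (MulAut F) f := hf
    exact inv_mem (zpow_mem this m)
  rw [Subgroup.mem_center_iff]
  rintro ⟨x, m⟩
  have h1 : ((φ ^ n)⁻¹ : MulAut F) x = f⁻¹ * x * f := by simp [hn]
  ext
  · simp [zpowersHom_apply, hpow, h1, mul_assoc]
  · simp [mul_comm]

lemma eq_one_of_isOfFinOrder_mappingTorus [IsMulTorsionFree F] {g : MappingTorus φ}
    (hg : IsOfFinOrder g) : g = 1 := by
  have hr : rightHom g = 1 := by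
    by_contra h
    exact not_isOfFinOrder_of_isMulTorsionFree h (rightHom.isOfFinOrder hg)
  obtain ⟨f, rfl⟩ : g ∈ (inl : F →* MappingTorus φ).range := by
    rwa [range_inl_eq_ker_rightHom]
  rw [inl_injective.isOfFinOrder_iff] at hg
  by_contra h
  exact not_isOfFinOrder_of_isMulTorsionFree (by rintro rfl; simp at h) hg

end MappingTorus

/-- if `F` is free of rank `M`, `[φ]` has finite order in
`Out(F)`, and `H` is a finitely generated subgroup of `G = F ⋊_φ ℤ` meeting
the center trivially, then `H` is free. -/
theorem fg_subgroup_avoiding_center_is_free {M : ℕ}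
    (φ : MulAut (FreeGroup (Fin M)))
    (hfin : ∃ k : ℕ, 0 < k ∧ ∃ f₀, φ ^ k = MulAut.conj f₀)
    (H : Subgroup (MappingTorus φ)) (hfg : H.FG)
    (htriv : H ⊓ Subgroup.center (MappingTorus φ) = ⊥) :
    ∃ S : Type, Nonempty (H ≃* FreeGroup S) := by
  obtain ⟨k, hk, f₀, hf₀⟩ := hfin
  obtain ⟨n, hn, f, hconj, hf⟩ := exists_pow_eq_conj_of_fixed hk hf₀
  set z : MappingTorus φ := inl f * inr (ofAdd (n : ℤ)) with hz
  have hzc : z ∈ Subgroup.center (MappingTorus φ) := inl_mul_inr_pow_mem_center hconj hf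
  have hzpow : ∀ m : ℤ, rightHom (z ^ m) = ofAdd (n : ℤ) ^ m := fun m ↦ by
    rw [map_zpow]; simp [hz]
  let j : FreeGroup (Fin M) × Multiplicative ℤ →* MappingTorus φ :=
    MonoidHom.noncommCoprod inl (zpowersHom _ z) fun x m ↦
      Subgroup.mem_center_iff.1 (zpow_mem hzc m.toAdd) _
  have hj : ∀ x m, j (x, m) = inl x * z ^ m.toAdd := fun _ _ ↦ rfl
  have hj_inj : Function.Injective j := by
    rw [injective_iff_map_eq_one]
    rintro ⟨x, m⟩ h
    rw [hj] at h
    have h' := congrArg rightHom h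
    have hm : m = 1 := by
      rw [map_mul, rightHom_inl, one_mul, hzpow, map_one, ← ofAdd_zsmul] at h'
      simpa [hn.ne'] using h'
    subst hm
    have hx : x = 1 := inl_injective (by simpa using h)
    rw [hx]; rfl
  have : NeZero n := ⟨hn.ne'⟩
  have hle : ((Int.castAddHom (ZMod n)).toMultiplicative.comp
      (rightHom : MappingTorus φ →* _)).ker ≤ j.range := by
    intro g hg
    obtain ⟨m, hm⟩ := (ZMod.intCast_zmod_eq_zero_iff_dvd _ n).1 hg
    obtain ⟨x, hx⟩ : g * (z ^ m)⁻¹ ∈ (inl : _ →* MappingTorus φ).range := by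
      rw [SemidirectProduct.range_inl_eq_ker_rightHom, MonoidHom.mem_ker, map_mul,
        map_inv (rightHom : MappingTorus φ →* _), hzpow, mul_inv_eq_one, ← ofAdd_zsmul,
        smul_eq_mul, mul_comm, ← hm]
      rfl
    exact ⟨(x, ofAdd m), by rw [hj, hx]; exact inv_mul_cancel_right _ _⟩
  have : j.range.FiniteIndex := Subgroup.finiteIndex_of_le hle
  have : Group.FG H := (Group.fg_iff_subgroup_fg H).2 hfg
  let ι : j.range.subgroupOf H →* FreeGroup (Fin M) :=
    ((MonoidHom.fst _ _).comp (MonoidHom.ofInjective hj_inj).symm.toMonoidHom).comp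
      (H.subtype.subgroupComap j.range)
  have hι : Function.Injective ι := by
    rw [injective_iff_map_eq_one]
    rintro ⟨⟨g, hgH⟩, ⟨⟨x, m⟩, hxm⟩⟩ h
    change j (x, m) = g at hxm
    subst hxm
    have hx : x = 1 := by
      rw [← h]
      exact congrArg Prod.fst
        ((MonoidHom.ofInjective hj_inj).symm_apply_apply (x, m)).symm
    have hmem : j (x, m) ∈ H ⊓ Subgroup.center (MappingTorus φ) := by
      refine ⟨hgH, ?_⟩
      rw [hj, hx, map_one, one_mul]
      exact zpow_mem hzc _
    rw [htriv, Subgroup.mem_bot] at hmem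
    exact Subtype.ext (Subtype.ext hmem)
  have : IsFreeGroup H := isFreeGroup_of_finiteIndex (fun g hg ↦ Subtype.ext
    (eq_one_of_isOfFinOrder_mappingTorus (H.subtype.isOfFinOrder hg))) hι
  exact ⟨_, ⟨IsFreeGroup.toFreeGroup H⟩⟩
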